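/- arXiv:1805.04610 — 3 statements merged into one kernel-verified Lean document; each statement's English description precedes it below -/
import Mathlib

section
/- For every ν ≥ 0, the depth-ν truncated Peres function Ψ_ν is extracting: for every n, every p ∈ [0,1], and every pair of binary strings z₁, z₂ of equal length, the sum of p^{#0(x)}·(1−p)^{#1(x)} over all x ∈ {0,1}^n with Ψ_ν(x) = z₁ equals the corresponding sum over x with Ψ_ν(x) = z₂. -/
/-- Split a binary string into consecutive non-overlapping pairs,
    discarding a final unpaired bit. -/
def pairList : List Bool → List (Bool × Bool)
  | a :: b :: rest => (a, b) :: pairList rest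
  | _ => []

theorem two_mul_pairList_length_le : ∀ x : List Bool, 2 * (pairList x).length ≤ x.length
  | [] => by simp [pairList]
  | [_] => by simp [pairList]
  | _ :: _ :: rest => by
      have := two_mul_pairList_length_le rest
      simp [pairList]; omega

/-- The von Neumann map: Ψ₁(00) = Ψ₁(11) = λ, Ψ₁(01) = 0, Ψ₁(10) = 1. -/
def vnExt (x : List Bool) : List Bool :=
  (pairList x).filterMap fun p => if p.1 = p.2 then none else some p.1

/-- u(ab) = a XOR b, applied pairwise. -/
def uExt (x : List Bool) : List Bool :=
  (pairList x).map fun p => xor p.1 p.2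

/-- v(00) = 0, v(11) = 1, v(01) = v(10) = λ, applied pairwise. -/
def vExt (x : List Bool) : List Bool :=
  (pairList x).filterMap fun p => if p.1 = p.2 then some p.1 else none

theorem uExt_length_lt {x : List Bool} (hx : x ≠ []) : (uExt x).length < x.length := by
  have h := two_mul_pairList_length_le x
  have : x.length ≠ 0 := by simpa using List.length_eq_zero_iff.not.mpr hx
  simp only [uExt, List.length_map]
  omega

theorem vExt_length_lt {x : List Bool} (hx : x ≠ []) : (vExt x).length < x.length := by
  have h := two_mul_pairList_length_le x
  have h2 := List.length_filterMap_le
    (fun p : Bool × Bool => if p.1 = p.2 then some p.1 else none) (pairList x)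
  have : x.length ≠ 0 := by simpa using List.length_eq_zero_iff.not.mpr hx
  simp only [vExt] at *
  omega

/-- The Peres function Ψ(x) = Ψ₁(x) * Ψ(u(x)) * Ψ(v(x)), Ψ(λ) = λ. -/
def peres (x : List Bool) : List Bool :=
  if h : x = [] then [] else
    vnExt x ++ peres (uExt x) ++ peres (vExt x)
termination_by x.length
decreasing_by
  · exact uExt_length_lt h
  · exact vExt_length_lt h

/-- Probability weight of a binary string under a Bernoulli(p for 0) source. -/
noncomputable def wt (p : ℝ) (x : List Bool) : ℝ :=
  p ^ (x.count false) * (1 - p) ^ (x.count true)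

/-- The depth-ν truncated Peres function: Ψ₀(x) = λ,
    Ψ_ν(x) = Ψ₁(x) * Ψ_{ν−1}(u(x)) * Ψ_{ν−1}(v(x)). -/
def peresTrunc : ℕ → List Bool → List Bool
  | 0, _ => []
  | ν + 1, x => vnExt x ++ peresTrunc ν (uExt x) ++ peresTrunc ν (vExt x)

/-- The final unpaired bit of a binary string, as a string of length at most one. -/
def unpaired : List Bool → List Bool
  | _ :: _ :: rest => unpaired rest
  | l => l

/-- Rebuild a binary string from its images under `uExt`, `vnExt`, `vExt` and `unpaired`. -/
def joinPairs : List Bool → List Bool → List Bool → List Bool → List Bool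
  | [], _, _, t => t
  | true :: u, c :: a, v, t => c :: (!c) :: joinPairs u a v t
  | false :: u, a, d :: v, t => d :: d :: joinPairs u a v t
  | _, _, _, _ => []

theorem length_unpaired_le : ∀ x : List Bool, (unpaired x).length ≤ 1
  | [] => by simp [unpaired]
  | [_] => by simp [unpaired]
  | _ :: _ :: rest => by simpa [unpaired] using length_unpaired_le rest

theorem length_vnExt : ∀ x : List Bool, (vnExt x).length = (uExt x).count true
  | [] => by simp [vnExt, uExt, pairList]
  | [_] => by simp [vnExt, uExt, pairList]
  | a :: b :: rest => by
      have := length_vnExt rest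
      cases a <;> cases b <;> simpa [vnExt, uExt, pairList] using this

theorem length_vExt : ∀ x : List Bool, (vExt x).length = (uExt x).count false
  | [] => by simp [vExt, uExt, pairList]
  | [_] => by simp [vExt, uExt, pairList]
  | a :: b :: rest => by
      have := length_vExt rest
      cases a <;> cases b <;> simpa [vExt, uExt, pairList] using this

theorem joinPairs_exts : ∀ x : List Bool,
    joinPairs (uExt x) (vnExt x) (vExt x) (unpaired x) = x
  | [] => by simp [vExt, uExt, vnExt, pairList, joinPairs, unpaired]
  | [_] => by simp [vExt, uExt, vnExt, pairList, joinPairs, unpaired]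
  | a :: b :: rest => by
      have := joinPairs_exts rest
      cases a <;> cases b <;>
        simpa [vExt, uExt, vnExt, pairList, joinPairs, unpaired] using this

theorem exts_joinPairs (u a v t : List Bool) (ha : a.length = u.count true)
    (hv : v.length = u.count false) (ht : t.length ≤ 1) :
    uExt (joinPairs u a v t) = u ∧ vnExt (joinPairs u a v t) = a ∧
      vExt (joinPairs u a v t) = v ∧ unpaired (joinPairs u a v t) = t := by
  induction u generalizing a v with
  | nil =>
    obtain rfl : a = [] := by simpa using ha
    obtain rfl : v = [] := by simpa using hv
    match t, ht with
    | [], _ => simp [vExt, uExt, vnExt, pairList, joinPairs, unpaired]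
    | [_], _ => simp [vExt, uExt, vnExt, pairList, joinPairs, unpaired]
  | cons b u ih =>
    cases b with
    | true =>
      obtain _ | ⟨c, a⟩ := a
      · simp at ha
      · have := ih a v (by simpa using ha) (by simpa using hv)
        cases c <;> simpa [vExt, uExt, vnExt, pairList, joinPairs, unpaired] using this
    | false =>
      obtain _ | ⟨d, v⟩ := v
      · simp at hv
      · have := ih a v (by simpa using ha) (by simpa using hv)
        cases d <;> simpa [vExt, uExt, vnExt, pairList, joinPairs, unpaired] using this

theorem count_joinPairs (b : Bool) (u a v t : List Bool) (ha : a.length = u.count true)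
    (hv : v.length = u.count false) :
    (joinPairs u a v t).count b = u.count true + 2 * v.count b + t.count b := by
  induction u generalizing a v with
  | nil =>
    obtain rfl : v = [] := by simpa using hv
    simp [joinPairs]
  | cons c u ih =>
    cases c with
    | true =>
      obtain _ | ⟨c, a⟩ := a
      · simp at ha
      · have := ih a v (by simpa using ha) (by simpa using hv)
        cases c <;> cases b <;> simp [joinPairs, this] <;> omega
    | false =>
      obtain _ | ⟨d, v⟩ := v
      · simp at hv
      · have := ih a v (by simpa using ha) (by simpa using hv)
        cases d <;> cases b <;> simp [joinPairs, this] <;> omega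

/-- XOR a binary string with an initial segment of an infinite mask. -/
def xorMask : (ℕ → Bool) → List Bool → List Bool
  | _, [] => []
  | m, b :: l => xor b (m 0) :: xorMask (fun i => m (i + 1)) l

theorem length_xorMask (m : ℕ → Bool) (l : List Bool) : (xorMask m l).length = l.length := by
  induction l generalizing m with
  | nil => rfl
  | cons b l ih => simp [xorMask, ih]

theorem xorMask_xorMask (m : ℕ → Bool) (l : List Bool) : xorMask m (xorMask m l) = l := by
  induction l generalizing m with
  | nil => rfl
  | cons b l ih => simp [xorMask, ih]

theorem xorMask_append (m : ℕ → Bool) (l₁ l₂ : List Bool) :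
    xorMask m (l₁ ++ l₂) = xorMask m l₁ ++ xorMask (fun i => m (i + l₁.length)) l₂ := by
  induction l₁ generalizing m with
  | nil => simp [xorMask]
  | cons b l ih => simp [xorMask, ih, add_assoc]

theorem exists_xorMask_eq (l₁ l₂ : List Bool) (h : l₁.length = l₂.length) :
    ∃ m, xorMask m l₁ = l₂ := by
  induction l₁ generalizing l₂ with
  | nil => exact ⟨fun _ => false, (List.length_eq_zero_iff.mp h.symm).symm⟩
  | cons b l ih =>
    obtain _ | ⟨c, l₂⟩ := l₂
    · simp at h
    · obtain ⟨m, hm⟩ := ih l₂ (by simpa using h)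
      exact ⟨fun i => Nat.casesOn i (xor b c) m, by simp [xorMask, hm]⟩

/-- The action of masks on inputs for which `peresTrunc ν` is equivariant. -/
def maskAct : ℕ → (ℕ → Bool) → List Bool → List Bool
  | 0, _, x => x
  | ν + 1, m, x =>
    joinPairs
      (maskAct ν (fun i => m (i + (vnExt x).length)) (uExt x))
      (xorMask m (vnExt x))
      (maskAct ν (fun i => m (i + (vnExt x ++ peresTrunc ν (uExt x)).length)) (vExt x))
      (unpaired x)

theorem length_eq_count_add_count (x : List Bool) :
    x.length = x.count false + x.count true :=
  (List.count_false_add_count_true x).symm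

theorem count_maskAct (ν : ℕ) (m : ℕ → Bool) (x : List Bool) (b : Bool) :
    (maskAct ν m x).count b = x.count b := by
  induction ν generalizing m x b with
  | zero => rfl
  | succ ν ih =>
    rw [maskAct, count_joinPairs, ih, ih]
    · conv_rhs => rw [← joinPairs_exts x]
      rw [count_joinPairs _ _ _ _ _ (length_vnExt x) (length_vExt x)]
    · rw [length_xorMask, ih, length_vnExt]
    · rw [length_eq_count_add_count, ih, ih, ih, ← length_eq_count_add_count, length_vExt]

theorem length_maskAct (ν : ℕ) (m : ℕ → Bool) (x : List Bool) :
    (maskAct ν m x).length = x.length := by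
  simp only [length_eq_count_add_count, count_maskAct]

theorem exts_maskAct_succ (ν : ℕ) (m : ℕ → Bool) (x : List Bool) :
    uExt (maskAct (ν + 1) m x) =
        maskAct ν (fun i => m (i + (vnExt x).length)) (uExt x) ∧
      vnExt (maskAct (ν + 1) m x) = xorMask m (vnExt x) ∧
      vExt (maskAct (ν + 1) m x) =
        maskAct ν (fun i => m (i + (vnExt x ++ peresTrunc ν (uExt x)).length)) (vExt x) ∧
      unpaired (maskAct (ν + 1) m x) = unpaired x :=
  exts_joinPairs _ _ _ _ (by rw [length_xorMask, count_maskAct, length_vnExt])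
    (by rw [length_maskAct, count_maskAct, length_vExt]) (length_unpaired_le x)

theorem peresTrunc_maskAct (ν : ℕ) (m : ℕ → Bool) (x : List Bool) :
    peresTrunc ν (maskAct ν m x) = xorMask m (peresTrunc ν x) := by
  induction ν generalizing m x with
  | zero => rfl
  | succ ν ih =>
    obtain ⟨hu, hn, hv, -⟩ := exts_maskAct_succ ν m x
    rw [peresTrunc, hu, hn, hv, ih, ih, peresTrunc, xorMask_append, xorMask_append]

theorem maskAct_maskAct (ν : ℕ) (m : ℕ → Bool) (x : List Bool) :
    maskAct ν m (maskAct ν m x) = x := by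
  induction ν generalizing m x with
  | zero => rfl
  | succ ν ih =>
    obtain ⟨hu, hn, hv, ht⟩ := exts_maskAct_succ ν m x
    conv_rhs => rw [← joinPairs_exts x]
    rw [maskAct, hu, hn, hv, ht]
    simp only [List.length_append, length_xorMask, peresTrunc_maskAct, xorMask_xorMask]
    rw [ih]
    simp only [← List.length_append]
    rw [ih]

/-- The action of a mask on the binary strings of length `n`, as a permutation. -/
def maskPerm (ν n : ℕ) (m : ℕ → Bool) : Equiv.Perm (Fin n → Bool) :=
  let f : (Fin n → Bool) → Fin n → Bool := fun x i =>
    (maskAct ν m (List.ofFn x))[i]'(by simp [length_maskAct])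
  have hf : ∀ x, List.ofFn (f x) = maskAct ν m (List.ofFn x) := fun x =>
    List.ext_getElem (by simp [length_maskAct]) (by simp [f])
  Function.Involutive.toPerm f fun x => List.ofFn_injective (by
    rw [hf, hf, maskAct_maskAct])

theorem ofFn_maskPerm (ν n : ℕ) (m : ℕ → Bool) (x : Fin n → Bool) :
    List.ofFn (maskPerm ν n m x) = maskAct ν m (List.ofFn x) :=
  List.ext_getElem (by simp [length_maskAct]) (by simp [maskPerm])

/-- Every truncated Peres function Ψ_ν is extracting. -/
theorem peresTrunc_extracting (ν n : ℕ) (p : ℝ) (hp : p ∈ Set.Icc (0 : ℝ) 1)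
    (z₁ z₂ : List Bool) (hz : z₁.length = z₂.length) :
    (∑ x : Fin n → Bool,
        if peresTrunc ν (List.ofFn x) = z₁ then wt p (List.ofFn x) else 0) =
    (∑ x : Fin n → Bool,
        if peresTrunc ν (List.ofFn x) = z₂ then wt p (List.ofFn x) else 0) := by
  obtain ⟨m, rfl⟩ := exists_xorMask_eq z₁ z₂ hz
  rw [← Equiv.sum_comp (maskPerm ν n m) fun x =>
    if peresTrunc ν (List.ofFn x) = xorMask m z₁ then wt p (List.ofFn x) else 0]
  have h_inj : Function.Injective (xorMask m) :=
    Function.Involutive.injective (xorMask_xorMask m)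
  simp only [ofFn_maskPerm, peresTrunc_maskAct, h_inj.eq_iff, wt, count_maskAct]
end

section
/- If x is a binary string with |x| ≤ 2^ν, then the Peres function and its depth-ν truncation agree on x: Ψ(x) = Ψ_ν(x). -/
theorem two_mul_uExt_length_le (x : List Bool) : 2 * (uExt x).length ≤ x.length := by
  simpa [uExt] using two_mul_pairList_length_le x

theorem two_mul_vExt_length_le (x : List Bool) : 2 * (vExt x).length ≤ x.length :=
  (Nat.mul_le_mul_left 2 (List.length_filterMap_le _ _)).trans (two_mul_pairList_length_le x)

theorem peres_nil : peres [] = [] := by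
  rw [peres, dif_pos rfl]

theorem peres_singleton (a : Bool) : peres [a] = [] := by
  rw [peres, dif_neg (List.cons_ne_nil _ _)]
  simp [vnExt, uExt, vExt, pairList, peres_nil]

/-- The Peres recursion holds for every string, including the empty one. -/
theorem peres_eq_append (x : List Bool) :
    peres x = vnExt x ++ peres (uExt x) ++ peres (vExt x) := by
  by_cases h : x = []
  · subst h
    simp [vnExt, uExt, vExt, pairList, peres_nil]
  · rw [peres, dif_neg h]

/-- If |x| ≤ 2^ν then the Peres function agrees with its depth-ν truncation. -/
theorem peres_eq_peresTrunc (ν : ℕ) (x : List Bool) (hx : x.length ≤ 2 ^ ν) :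
    peres x = peresTrunc ν x := by
  induction ν generalizing x with
  | zero =>
    match x, hx with
    | [], _ => exact peres_nil
    | [a], _ => exact peres_singleton a
    | _ :: _ :: _, hx => simp at hx
  | succ ν ih =>
    have hu := two_mul_uExt_length_le x
    have hv := two_mul_vExt_length_le x
    rw [pow_succ] at hx
    rw [peres_eq_append, peresTrunc, ih (uExt x) (by omega), ih (vExt x) (by omega)]
end

section
/- The 3-face Peres function Ψ is extracting: for every n, every probability distribution ⟨p, q, r⟩ with p + q + r = 1 and p, q, r ≥ 0, and every pair of binary strings z₁, z₂ of equal length, the sum of p^{#0(x)}·q^{#1(x)}·r^{#2(x)} over all x ∈ {0,1,2}^n with Ψ(x) = z₁ equals the corresponding sum over x with Ψ(x) = z₂. -/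
/-- Split a ternary string into consecutive non-overlapping pairs,
    discarding a final unpaired symbol. -/
def pairList3 : List (Fin 3) → List (Fin 3 × Fin 3)
  | a :: b :: rest => (a, b) :: pairList3 rest
  | _ => []

theorem two_mul_pairList3_length_le : ∀ x : List (Fin 3), 2 * (pairList3 x).length ≤ x.length
  | [] => by simp [pairList3]
  | [_] => by simp [pairList3]
  | _ :: _ :: rest => by
      have := two_mul_pairList3_length_le rest
      simp [pairList3]; omega

/-- Ψ₁ sends 00,11,22 ↦ λ; 01,02,12 ↦ 0; 10,20,21 ↦ 1, pairwise. -/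
def vn3 (x : List (Fin 3)) : List Bool :=
  (pairList3 x).filterMap fun p => if p.1 = p.2 then none else some (decide (p.2 < p.1))

/-- u sends 00,11,22 ↦ 0 and every other pair ↦ 1, pairwise. -/
def u3 (x : List (Fin 3)) : List (Fin 3) :=
  (pairList3 x).map fun p => if p.1 = p.2 then 0 else 1

/-- v sends 00 ↦ 0, 11 ↦ 1, 22 ↦ 2, other pairs ↦ λ, pairwise. -/
def v3 (x : List (Fin 3)) : List (Fin 3) :=
  (pairList3 x).filterMap fun p => if p.1 = p.2 then some p.1 else none

/-- w sends 01,10 ↦ 1; 02,20 ↦ 2; 12,21 ↦ 0; 00,11,22 ↦ λ, pairwise. -/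
def w3 (x : List (Fin 3)) : List (Fin 3) :=
  (pairList3 x).filterMap fun p => if p.1 = p.2 then none else some (p.1 + p.2)

theorem u3_length_lt {x : List (Fin 3)} (hx : x ≠ []) : (u3 x).length < x.length := by
  have h := two_mul_pairList3_length_le x
  have : x.length ≠ 0 := by simpa using List.length_eq_zero_iff.not.mpr hx
  simp only [u3, List.length_map]; omega

theorem v3_length_lt {x : List (Fin 3)} (hx : x ≠ []) : (v3 x).length < x.length := by
  have h := two_mul_pairList3_length_le x
  have h2 := List.length_filterMap_le
    (fun p : Fin 3 × Fin 3 => if p.1 = p.2 then some p.1 else none) (pairList3 x)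
  have : x.length ≠ 0 := by simpa using List.length_eq_zero_iff.not.mpr hx
  simp only [v3] at *; omega

theorem w3_length_lt {x : List (Fin 3)} (hx : x ≠ []) : (w3 x).length < x.length := by
  have h := two_mul_pairList3_length_le x
  have h2 := List.length_filterMap_le
    (fun p : Fin 3 × Fin 3 => if p.1 = p.2 then none else some (p.1 + p.2)) (pairList3 x)
  have : x.length ≠ 0 := by simpa using List.length_eq_zero_iff.not.mpr hx
  simp only [w3] at *; omega

/-- The 3-face Peres function Ψ(x) = Ψ₁(x) * Ψ(u(x)) * Ψ(v(x)) * Ψ(w(x)). -/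
def peres3 (x : List (Fin 3)) : List Bool :=
  if h : x = [] then [] else
    vn3 x ++ peres3 (u3 x) ++ peres3 (v3 x) ++ peres3 (w3 x)
termination_by x.length
decreasing_by
  · exact u3_length_lt h
  · exact v3_length_lt h
  · exact w3_length_lt h

/-- Probability weight p^{#0(x)}·q^{#1(x)}·r^{#2(x)} of a ternary string. -/
noncomputable def wt3 (p q r : ℝ) (x : List (Fin 3)) : ℝ :=
  p ^ (x.count 0) * q ^ (x.count 1) * r ^ (x.count 2)

/-- The final unpaired symbol of a ternary string, if any. -/
def unpaired3 : List (Fin 3) → List (Fin 3)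
  | _ :: _ :: rest => unpaired3 rest
  | x => x

/-- The increasing pair of distinct symbols that `w3` sends to the given symbol. -/
def distinctPair3 : Fin 3 → Fin 3 × Fin 3
  | 0 => (1, 2)
  | 1 => (0, 1)
  | 2 => (0, 2)

/-- Rebuild a ternary string from its images under `u3`, `vn3`, `v3`, `w3` and `unpaired3`. -/
def assemble3 (t : List (Fin 3)) :
    List (Fin 3) → List Bool → List (Fin 3) → List (Fin 3) → List (Fin 3)
  | 0 :: u, b, c :: v, w => c :: c :: assemble3 t u b v w
  | 1 :: u, β :: b, v, c :: w =>
      if β then (distinctPair3 c).2 :: (distinctPair3 c).1 :: assemble3 t u b v w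
      else (distinctPair3 c).1 :: (distinctPair3 c).2 :: assemble3 t u b v w
  | _, _, _, _ => t

/-- The quadruples that occur as images of a ternary string under `u3`, `vn3`, `v3`, `w3`. -/
inductive Compatible3 :
    List (Fin 3) → List Bool → List (Fin 3) → List (Fin 3) → Prop
  | nil : Compatible3 [] [] [] []
  | same {u b v w} (c : Fin 3) : Compatible3 u b v w → Compatible3 (0 :: u) b (c :: v) w
  | diff {u b v w} (β : Bool) (c : Fin 3) :
      Compatible3 u b v w → Compatible3 (1 :: u) (β :: b) v (c :: w)

theorem compatible3_of_length : ∀ {u : List (Fin 3)} {b : List Bool} {v w : List (Fin 3)},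
    u.count 2 = 0 → v.length = u.count 0 → b.length = u.count 1 → w.length = u.count 1 →
    Compatible3 u b v w
  | [], b, v, w, _, hv, hb, hw => by
      simp at hv hb hw
      subst hv hb hw
      exact .nil
  | a :: u, b, v, w, h2, hv, hb, hw => by
      fin_cases a
      · cases v with
        | nil => simp at hv
        | cons c v =>
          exact .same c (compatible3_of_length (by simpa using h2) (by simpa using hv)
            (by simpa using hb) (by simpa using hw))
      · cases b with
        | nil => simp at hb
        | cons β b =>
          cases w with
          | nil => simp at hw
          | cons c w =>
            exact .diff β c (compatible3_of_length (by simpa using h2) (by simpa using hv)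
              (by simpa using hb) (by simpa using hw))
      · simp at h2

theorem Compatible3.count {u : List (Fin 3)} {b : List Bool} {v w : List (Fin 3)}
    (h : Compatible3 u b v w) :
    u.count 2 = 0 ∧ v.length = u.count 0 ∧ b.length = u.count 1 ∧ w.length = u.count 1 := by
  induction h <;> simp_all

theorem compatible3_images : ∀ x : List (Fin 3), Compatible3 (u3 x) (vn3 x) (v3 x) (w3 x)
  | [] => .nil
  | [_] => .nil
  | a :: b :: rest => by
      have ih := compatible3_images rest
      by_cases hab : a = b
      · simpa [u3, vn3, v3, w3, pairList3, hab] using ih.same b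
      · simpa [u3, vn3, v3, w3, pairList3, hab] using ih.diff (decide (b < a)) (a + b)

theorem Compatible3.images_assemble3 {t u : List (Fin 3)} {b : List Bool} {v w : List (Fin 3)}
    (ht : t.length ≤ 1) (h : Compatible3 u b v w) :
    u3 (assemble3 t u b v w) = u ∧ vn3 (assemble3 t u b v w) = b ∧
      v3 (assemble3 t u b v w) = v ∧ w3 (assemble3 t u b v w) = w ∧
      unpaired3 (assemble3 t u b v w) = t := by
  induction h with
  | nil =>
    match t, ht with
    | [], _ => simp [assemble3, u3, vn3, v3, w3, pairList3, unpaired3]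
    | [_], _ => simp [assemble3, u3, vn3, v3, w3, pairList3, unpaired3]
  | same c _ ih =>
    simp only [u3, vn3, v3, w3] at ih
    simp [assemble3, u3, vn3, v3, w3, pairList3, unpaired3, ih]
  | diff β c _ ih =>
    simp only [u3, vn3, v3, w3] at ih
    cases β <;> fin_cases c <;>
      simp [assemble3, u3, vn3, v3, w3, pairList3, unpaired3, distinctPair3, ih]

theorem assemble3_images : ∀ x : List (Fin 3),
    assemble3 (unpaired3 x) (u3 x) (vn3 x) (v3 x) (w3 x) = x
  | [] => rfl
  | [_] => rfl
  | a :: b :: rest => by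
      have ih := assemble3_images rest
      simp only [u3, vn3, v3, w3] at ih
      fin_cases a <;> fin_cases b <;>
        simpa [u3, vn3, v3, w3, pairList3, unpaired3, assemble3, distinctPair3] using ih

theorem unpaired3_length_le : ∀ x : List (Fin 3), (unpaired3 x).length ≤ 1
  | [] => by simp [unpaired3]
  | [_] => by simp [unpaired3]
  | _ :: _ :: rest => by simpa [unpaired3] using unpaired3_length_le rest

theorem Compatible3.assemble3_perm {t u : List (Fin 3)} {b : List Bool} {v w : List (Fin 3)}
    (h : Compatible3 u b v w) :
    (assemble3 t u b v w).Perm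
      (v ++ v ++ w.flatMap (fun c => [(distinctPair3 c).1, (distinctPair3 c).2]) ++ t) := by
  induction h with
  | nil => simp [assemble3]
  | same c _ ih =>
    rw [List.perm_iff_count] at ih ⊢
    intro a
    have := ih a
    simp [assemble3, List.count_cons] at this ⊢
    omega
  | diff β c _ ih =>
    rw [List.perm_iff_count] at ih ⊢
    intro a
    have := ih a
    cases β <;> simp [assemble3, List.count_cons] at this ⊢ <;> omega

theorem peres3_of_ne_nil {x : List (Fin 3)} (hx : x ≠ []) :
    peres3 x = vn3 x ++ peres3 (u3 x) ++ peres3 (v3 x) ++ peres3 (w3 x) := by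
  rw [peres3, dif_neg hx]

/-- Rearrange `x` so that its image under `peres3` becomes `z`. -/
def rearrange3 (z : List Bool) (x : List (Fin 3)) : List (Fin 3) :=
  if h : x = [] then [] else
    assemble3 (unpaired3 x)
      (rearrange3 ((z.drop (vn3 x).length).take (peres3 (u3 x)).length) (u3 x))
      (z.take (vn3 x).length)
      (rearrange3 (((z.drop (vn3 x).length).drop (peres3 (u3 x)).length).take
        (peres3 (v3 x)).length) (v3 x))
      (rearrange3 (((z.drop (vn3 x).length).drop (peres3 (u3 x)).length).drop
        (peres3 (v3 x)).length) (w3 x))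
termination_by x.length
decreasing_by
  · exact u3_length_lt h
  · exact v3_length_lt h
  · exact w3_length_lt h

theorem rearrange3_append {x : List (Fin 3)} (hx : x ≠ []) {z₀ z₁ z₂ : List Bool}
    (z₃ : List Bool) (h₀ : z₀.length = (vn3 x).length)
    (h₁ : z₁.length = (peres3 (u3 x)).length) (h₂ : z₂.length = (peres3 (v3 x)).length) :
    rearrange3 (z₀ ++ z₁ ++ z₂ ++ z₃) x =
      assemble3 (unpaired3 x) (rearrange3 z₁ (u3 x)) z₀
        (rearrange3 z₂ (v3 x)) (rearrange3 z₃ (w3 x)) := by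
  rw [rearrange3, dif_neg hx, ← h₀, ← h₁, ← h₂]
  simp only [List.append_assoc, List.drop_left, List.take_left]

theorem exists_append_of_length_eq {α : Type*} {z a b : List α}
    (h : z.length = (a ++ b).length) :
    ∃ z₁ z₂, z = z₁ ++ z₂ ∧ z₁.length = a.length ∧ z₂.length = b.length := by
  refine ⟨z.take a.length, z.drop a.length, (List.take_append_drop _ _).symm, ?_, ?_⟩ <;>
    simp at h ⊢ <;> omega

theorem rearrange3_spec (x : List (Fin 3)) {z : List Bool} (hz : z.length = (peres3 x).length) :
    peres3 (rearrange3 z x) = z ∧ (rearrange3 z x).Perm x ∧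
      rearrange3 (peres3 x) (rearrange3 z x) = x := by
  induction hn : x.length using Nat.strong_induction_on generalizing x z with
  | _ n ih =>
  subst hn
  by_cases hx : x = []
  · subst hx
    have hnil : peres3 [] = [] := by simp [peres3]
    have hz' : z = [] := by simpa [hnil] using hz
    subst hz'
    simp [rearrange3, hnil]
  · rw [peres3_of_ne_nil hx] at hz
    obtain ⟨z', z₃, rfl, hz', h₃⟩ := exists_append_of_length_eq hz
    obtain ⟨z', z₂, rfl, hz', h₂⟩ := exists_append_of_length_eq hz'
    obtain ⟨z₀, z₁, rfl, h₀, h₁⟩ := exists_append_of_length_eq hz'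
    obtain ⟨uΨ, uperm, uinv⟩ := ih _ (u3_length_lt hx) (u3 x) h₁ rfl
    obtain ⟨vΨ, vperm, vinv⟩ := ih _ (v3_length_lt hx) (v3 x) h₂ rfl
    obtain ⟨wΨ, wperm, winv⟩ := ih _ (w3_length_lt hx) (w3 x) h₃ rfl
    have hx' := compatible3_images x
    obtain ⟨c₂, cv, cb, cw⟩ := hx'.count
    have hc : Compatible3 (rearrange3 z₁ (u3 x)) z₀ (rearrange3 z₂ (v3 x))
        (rearrange3 z₃ (w3 x)) := by
      apply compatible3_of_length
      · rw [uperm.count_eq, c₂]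
      · rw [uperm.count_eq, vperm.length_eq, cv]
      · rw [uperm.count_eq, h₀, cb]
      · rw [uperm.count_eq, wperm.length_eq, cw]
    have hperm : (rearrange3 (z₀ ++ z₁ ++ z₂ ++ z₃) x).Perm x := by
      rw [rearrange3_append hx z₃ h₀ h₁ h₂]
      have hxperm := hx'.assemble3_perm (t := unpaired3 x)
      rw [assemble3_images] at hxperm
      exact hc.assemble3_perm.trans <|
        ((((vperm.append vperm).append (wperm.flatMap_right _)).append_right _)).trans hxperm.symm
    have hne : rearrange3 (z₀ ++ z₁ ++ z₂ ++ z₃) x ≠ [] := fun h => by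
      rw [h] at hperm
      exact hx hperm.symm.eq_nil
    obtain ⟨eu, eb, ev, ew, et⟩ := hc.images_assemble3 (unpaired3_length_le x)
    rw [← rearrange3_append hx z₃ h₀ h₁ h₂] at eu eb ev ew et
    refine ⟨?_, hperm, ?_⟩
    · rw [peres3_of_ne_nil hne, eu, eb, ev, ew, uΨ, vΨ, wΨ]
    · rw [peres3_of_ne_nil hx, rearrange3_append hne, eu, ev, ew, et, uinv, vinv, winv,
        assemble3_images]
      · rw [eb, h₀]
      · rw [eu, uΨ, h₁]
      · rw [ev, vΨ, h₂]

theorem wt3_perm (p q r : ℝ) {x y : List (Fin 3)} (h : x.Perm y) : wt3 p q r x = wt3 p q r y := by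
  simp only [wt3, h.count_eq]

theorem List.ofFn_getD {α : Type*} {n : ℕ} (d : α) {l : List α} (h : l.length = n) :
    List.ofFn (fun i : Fin n => l.getD i d) = l := by
  subst h
  exact List.ext_getElem (by simp) (by simp)

/-- The 3-face Peres function is extracting. -/
theorem peres3_extracting (n : ℕ) (p q r : ℝ)
    (hp : 0 ≤ p) (hq : 0 ≤ q) (hr : 0 ≤ r) (hsum : p + q + r = 1)
    (z₁ z₂ : List Bool) (hz : z₁.length = z₂.length) :
    (∑ x : Fin n → Fin 3,
        if peres3 (List.ofFn x) = z₁ then wt3 p q r (List.ofFn x) else 0) =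
    (∑ x : Fin n → Fin 3,
        if peres3 (List.ofFn x) = z₂ then wt3 p q r (List.ofFn x) else 0) := by
  have hofFn {z : List Bool} {x : Fin n → Fin 3}
      (h : z.length = (peres3 (List.ofFn x)).length) :
      List.ofFn (fun i : Fin n => (rearrange3 z (List.ofFn x)).getD i 0) =
        rearrange3 z (List.ofFn x) :=
    List.ofFn_getD 0 (by simpa using (rearrange3_spec _ h).2.1.length_eq)
  have hmem {z z' : List Bool} (h : z'.length = z.length) (x : Fin n → Fin 3)
      (hx : peres3 (List.ofFn x) = z) :
      peres3 (List.ofFn fun i : Fin n => (rearrange3 z' (List.ofFn x)).getD i 0) = z' := by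
    subst hx
    rw [hofFn h, (rearrange3_spec _ h).1]
  have hinv {z z' : List Bool} (h : z'.length = z.length) (x : Fin n → Fin 3)
      (hx : peres3 (List.ofFn x) = z) :
      (fun i : Fin n => (rearrange3 z (List.ofFn fun i : Fin n =>
        (rearrange3 z' (List.ofFn x)).getD i 0)).getD i 0) = x := by
    subst hx
    rw [hofFn h, (rearrange3_spec _ h).2.2]
    ext i
    simp
  rw [← Finset.sum_filter, ← Finset.sum_filter]
  refine Finset.sum_bij'
    (fun x _ => fun i : Fin n => (rearrange3 z₂ (List.ofFn x)).getD i 0)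
    (fun x _ => fun i : Fin n => (rearrange3 z₁ (List.ofFn x)).getD i 0) ?_ ?_ ?_ ?_ ?_
  · intro x hx
    simpa using hmem hz.symm x (by simpa using hx)
  · intro x hx
    simpa using hmem hz x (by simpa using hx)
  · intro x hx
    exact hinv hz.symm x (by simpa using hx)
  · intro x hx
    exact hinv hz x (by simpa using hx)
  · intro x hx
    have hx' : peres3 (List.ofFn x) = z₁ := by simpa using hx
    have h : z₂.length = (peres3 (List.ofFn x)).length := by rw [hx', hz]
    rw [hofFn h, wt3_perm p q r (rearrange3_spec _ h).2.1]
end
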